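/- arXiv:math/9910031 — 2 statements merged into one kernel-verified Lean document; each statement's English description precedes it below -/
import Mathlib

section
/- Let A be a C*-algebra and let (J_i)_{i∈I} be a covering of A consisting of closed two-sided ideals. Then the covering is complete, i.e. for every family (b_i)_{i∈I} of elements of A with b_i − b_j ∈ J_i + J_j for all i, j ∈ I there exists b ∈ A with b − b_i ∈ J_i for all i ∈ I. -/
namespace CStarCovering

variable {A : Type*} [CStarAlgebra A]

lemma aeval_sub_aeval_mem (K : TwoSidedIdeal A) {x y : A} (hxy : x - y ∈ K)
    (p : Polynomial ℝ) : Polynomial.aeval x p - Polynomial.aeval y p ∈ K := by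
  induction p using Polynomial.induction_on with
  | C r => simp
  | add p q hp hq =>
    rw [map_add, map_add, add_sub_add_comm]
    exact K.add_mem hp hq
  | monomial n r h =>
    rw [pow_succ, ← mul_assoc]
    generalize Polynomial.C r * Polynomial.X ^ n = P at h ⊢
    simp only [map_mul, Polynomial.aeval_X]
    have key : Polynomial.aeval x P * x - Polynomial.aeval y P * y
        = (Polynomial.aeval x P - Polynomial.aeval y P) * x
          + Polynomial.aeval y P * (x - y) := by
      noncomm_ring
    rw [key]
    exact K.add_mem (K.mul_mem_right _ _ h) (K.mul_mem_left _ _ hxy)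

/-- The continuous functional calculus respects congruence modulo a closed ideal. -/
lemma cfc_sub_cfc_mem {K : TwoSidedIdeal A} (hK : IsClosed (K : Set A)) {x y : A}
    (hx : IsSelfAdjoint x) (hy : IsSelfAdjoint y) (hxy : x - y ∈ K)
    {f : ℝ → ℝ} (hf : Continuous f) : cfc f x - cfc f y ∈ K := by
  obtain ⟨R, hR⟩ : ∃ R : ℝ, ∀ t ∈ spectrum ℝ x ∪ spectrum ℝ y, t ∈ Set.Icc (-R) R := by
    obtain ⟨R, hR⟩ := ((spectrum.isCompact (𝕜 := ℝ) x).union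
      (spectrum.isCompact (𝕜 := ℝ) y)).isBounded.exists_norm_le
    exact ⟨R, fun t ht => abs_le.mp (hR t ht)⟩
  suffices h : cfc f x - cfc f y ∈ closure (K : Set A) by
    rwa [hK.closure_eq] at h
  refine Metric.mem_closure_iff.mpr fun ε hε => ?_
  obtain ⟨p, hp⟩ := exists_polynomial_near_of_continuousOn (-R) R f hf.continuousOn (ε / 4)
    (by positivity)
  refine ⟨_, aeval_sub_aeval_mem K hxy p, ?_⟩
  have approx : ∀ z : A, IsSelfAdjoint z → spectrum ℝ z ⊆ spectrum ℝ x ∪ spectrum ℝ y →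
      ‖cfc f z - Polynomial.aeval z p‖ ≤ ε / 4 := by
    intro z hz hsub
    rw [← cfc_polynomial p z hz, ← cfc_sub f p.eval z hf.continuousOn p.continuous.continuousOn]
    refine norm_cfc_le (by positivity) fun t ht => ?_
    rw [Real.norm_eq_abs, abs_sub_comm]
    exact (hp t (hR t (hsub ht))).le
  calc dist (cfc f x - cfc f y) (Polynomial.aeval x p - Polynomial.aeval y p)
      = ‖(cfc f x - Polynomial.aeval x p) - (cfc f y - Polynomial.aeval y p)‖ := by
        rw [dist_eq_norm]; congr 1; abel
    _ ≤ ε / 4 + ε / 4 := (norm_sub_le _ _).trans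
        (add_le_add (approx x hx Set.subset_union_left) (approx y hy Set.subset_union_right))
    _ < ε := by linarith

lemma cfc_mem {K : TwoSidedIdeal A} (hK : IsClosed (K : Set A)) {x : A}
    (hx : IsSelfAdjoint x) (hxK : x ∈ K) {f : ℝ → ℝ} (hf : Continuous f) (hf0 : f 0 = 0) :
    cfc f x ∈ K := by
  have h := cfc_sub_cfc_mem hK hx (IsSelfAdjoint.zero A) (by simpa using hxK) hf
  simpa [cfc_apply_zero, hf0] using h

lemma norm_mul_cfc_star_mul_self_le (x : A) {f : ℝ → ℝ} (hf : Continuous f) {c : ℝ}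
    (hc : 0 ≤ c) (h : ∀ t, 0 ≤ t → |√t * f t| ≤ c) :
    ‖x * cfc f (star x * x)‖ ≤ c := by
  have hsa : IsSelfAdjoint (star x * x) := .star_mul_self x
  refine abs_le_of_sq_le_sq' ?_ hc |>.2
  have e : star (x * cfc f (star x * x)) * (x * cfc f (star x * x))
      = cfc (fun t => f t * t * f t) (star x * x) := by
    rw [cfc_mul (fun t => f t * t) f _ (by fun_prop) (by fun_prop),
      cfc_mul f (fun t => t) _ (by fun_prop) (by fun_prop), cfc_id' ℝ (star x * x) hsa,
      star_mul, (cfc_predicate f (star x * x) : IsSelfAdjoint _).star_eq]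
    simp only [mul_assoc]
  rw [sq, ← CStarRing.norm_star_mul_self, e]
  refine norm_cfc_le (by positivity) fun t ht => ?_
  have ht0 : 0 ≤ t := spectrum_star_mul_self_nonneg t ht
  have e2 : f t * t * f t = (√t * f t) ^ 2 := by
    rw [mul_pow, Real.sq_sqrt ht0]; ring
  rw [e2, Real.norm_eq_abs, abs_pow]
  exact pow_le_pow_left₀ (abs_nonneg _) (h t ht0) 2

lemma abs_sq_mul_inv_max_sub_le {q δ : ℝ} (hq : 0 ≤ q) (hδ : 0 < δ) :
    |q ^ 2 * (max q δ)⁻¹ - q| ≤ δ := by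
  rcases le_total δ q with h | h
  · have : 0 < q := hδ.trans_le h
    rw [max_eq_left h, show q ^ 2 * q⁻¹ - q = 0 by field_simp; ring]
    simpa using hδ.le
  · rw [max_eq_right h, ← div_eq_mul_inv]
    have h1 : q ^ 2 / δ ≤ q := by rw [div_le_iff₀ hδ]; nlinarith
    have h2 : 0 ≤ q ^ 2 / δ := by positivity
    rw [abs_le]
    constructor <;> linarith

lemma abs_sq_mul_inv_max_mul_sub_one_le {q δ : ℝ} (hq : 0 ≤ q) (hδ : 0 < δ) :
    |q ^ 2 * ((max q δ)⁻¹ * q - 1)| ≤ δ ^ 2 := by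
  rcases le_total δ q with h | h
  · have : 0 < q := hδ.trans_le h
    rw [max_eq_left h, inv_mul_cancel₀ this.ne']
    simpa using sq_nonneg δ
  · rw [max_eq_right h, abs_mul, abs_of_nonneg (sq_nonneg q)]
    have h1 : δ⁻¹ * q ≤ 1 := by rw [inv_mul_le_iff₀ hδ]; linarith
    have h2 : 0 ≤ δ⁻¹ * q := by positivity
    have h3 : |δ⁻¹ * q - 1| ≤ 1 := by rw [abs_le]; constructor <;> linarith
    calc q ^ 2 * |δ⁻¹ * q - 1| ≤ q ^ 2 * 1 := by gcongr
      _ ≤ δ ^ 2 := by rw [mul_one]; gcongr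

/-- Every element `x` factors through the fourth root of `star x * x`. -/
lemma exists_eq_mul_cfc_sqrt_sqrt (x : A) :
    ∃ w : A, x = w * cfc (fun t : ℝ => √√t) (star x * x) := by
  have hsa : IsSelfAdjoint (star x * x) := .star_mul_self x
  set δ : ℕ → ℝ := fun n => 1 / ((n : ℝ) + 1) with hδ_def
  have hδ : ∀ n, 0 < δ n := fun n => by positivity
  have hδ_lim : Filter.Tendsto δ Filter.atTop (nhds 0) := tendsto_one_div_add_atTop_nhds_zero_nat
  have hδ_anti : Antitone δ := fun m n h => one_div_le_one_div_of_le (by positivity) (by gcongr)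
  set f : ℕ → ℝ → ℝ := fun n t => (max √√t (δ n))⁻¹ with hf_def
  have hf : ∀ n, Continuous (f n) := fun n =>
    Continuous.inv₀ (by fun_prop) fun t => ((hδ n).trans_le (le_max_right _ _)).ne'
  have hsq : ∀ t : ℝ, √t = √√t ^ 2 := fun t => (Real.sq_sqrt (Real.sqrt_nonneg t)).symm
  have hcauchy : CauchySeq fun n => x * cfc (f n) (star x * x) := by
    refine cauchySeq_of_le_tendsto_0 (fun n => 2 * δ n) (fun m n N hm hn => ?_)
      (by simpa using hδ_lim.const_mul 2)
    rw [dist_eq_norm, ← mul_sub,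
      ← cfc_sub (f m) (f n) _ (hf m).continuousOn (hf n).continuousOn]
    refine norm_mul_cfc_star_mul_self_le x ((hf m).sub (hf n)) (by linarith [hδ N])
      fun t _ => ?_
    have hm' := abs_sq_mul_inv_max_sub_le (Real.sqrt_nonneg √t) (hδ m)
    have hn' := abs_sq_mul_inv_max_sub_le (Real.sqrt_nonneg √t) (hδ n)
    rw [← hsq] at hm' hn'
    calc |√t * (f m t - f n t)| = |(√t * f m t - √√t) - (√t * f n t - √√t)| := by ring_nf
      _ ≤ δ m + δ n := (abs_sub _ _).trans (add_le_add hm' hn')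
      _ ≤ 2 * δ N := by linarith [hδ_anti hm, hδ_anti hn]
  obtain ⟨w, hw⟩ := cauchySeq_tendsto_of_complete hcauchy
  refine ⟨w, tendsto_nhds_unique ?_ (hw.mul_const _)⟩
  rw [tendsto_iff_norm_sub_tendsto_zero]
  refine squeeze_zero (fun _ => norm_nonneg _) (fun n => ?_)
    (by simpa using hδ_lim.pow 2)
  have e : x * cfc (f n) (star x * x) * cfc (fun t : ℝ => √√t) (star x * x) - x
      = x * cfc (fun t => f n t * √√t - 1) (star x * x) := by
    rw [cfc_sub (fun t => f n t * √√t) (fun _ => 1) _ ((hf n).mul (by fun_prop)).continuousOn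
        (by fun_prop), cfc_mul (f n) _ _ (hf n).continuousOn (by fun_prop),
      cfc_const_one ℝ (star x * x) hsa, mul_sub, mul_one, mul_assoc]
  rw [e]
  refine norm_mul_cfc_star_mul_self_le x (((hf n).mul (by fun_prop)).sub continuous_const)
    (sq_nonneg _) fun t _ => ?_
  have h := abs_sq_mul_inv_max_mul_sub_one_le (Real.sqrt_nonneg √t) (hδ n)
  rwa [← hsq] at h

/-- Closed two-sided ideals are self-adjoint. -/
lemma star_mem_of_isClosed {K : TwoSidedIdeal A} (hK : IsClosed (K : Set A)) {x : A}
    (hx : x ∈ K) : star x ∈ K := by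
  obtain ⟨w, hw⟩ := exists_eq_mul_cfc_sqrt_sqrt (star x)
  rw [hw]
  refine K.mul_mem_left _ _ (cfc_mem hK (.star_mul_self _) ?_ (by fun_prop) (by simp))
  rw [star_star]
  exact K.mul_mem_right _ _ hx

/-- If `x ∈ I` is congruent to `y` modulo `K`, then modulo `K` it is congruent to an element
of `I` lying in every closed ideal that contains `y`. -/
lemma exists_mem_forall_mem_of_sub_mem {I K : TwoSidedIdeal A} (hI : IsClosed (I : Set A))
    (hK : IsClosed (K : Set A)) {x y : A} (hx : x ∈ I) (hxy : x - y ∈ K) :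
    ∃ c ∈ I, x - c ∈ K ∧ ∀ L : TwoSidedIdeal A, IsClosed (L : Set A) → y ∈ L → c ∈ L := by
  obtain ⟨w, hw⟩ := exists_eq_mul_cfc_sqrt_sqrt x
  set h : ℝ → ℝ := fun t => √√√t with h_def
  have hcont : Continuous h := by fun_prop
  have h0 : h 0 = 0 := by simp [h]
  have hsq : cfc (fun t : ℝ => √√t) (star x * x)
      = cfc h (star x * x) * cfc h (star x * x) := by
    rw [← cfc_mul h h _ hcont.continuousOn hcont.continuousOn]
    congr 1
    funext t
    exact (Real.mul_self_sqrt (Real.sqrt_nonneg _)).symm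
  refine ⟨w * cfc h (star x * x) * cfc h (star y * y), ?_, ?_, fun L hL hy => ?_⟩
  · exact I.mul_mem_right _ _ <| I.mul_mem_left _ _ <|
      cfc_mem hI (.star_mul_self x) (I.mul_mem_left _ _ hx) hcont h0
  · have hsub : star x * x - star y * y ∈ K := by
      have key : star x * x - star y * y = star x * (x - y) + star (x - y) * y := by
        rw [star_sub]; noncomm_ring
      rw [key]
      exact K.add_mem (K.mul_mem_left _ _ hxy)
        (K.mul_mem_right _ _ (star_mem_of_isClosed hK hxy))
    have key : x - w * cfc h (star x * x) * cfc h (star y * y)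
        = w * cfc h (star x * x) * (cfc h (star x * x) - cfc h (star y * y)) := by
      rw [mul_sub, mul_assoc w _ (cfc h (star x * x)), ← hsq, ← hw]
    rw [key]
    exact K.mul_mem_left _ _
      (cfc_sub_cfc_mem hK (.star_mul_self x) (.star_mul_self y) hsub hcont)
  · exact L.mul_mem_left _ _ (cfc_mem hL (.star_mul_self y) (L.mul_mem_left _ _ hy) hcont h0)

/-- Adding a closed ideal distributes over finite intersections of closed ideals. -/
lemma exists_forall_mem_of_forall_exists_add {ι : Type*} {J : ι → TwoSidedIdeal A}
    (hJ : ∀ i, IsClosed (J i : Set A)) {K : TwoSidedIdeal A} (hK : IsClosed (K : Set A))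
    (s : Finset ι) {x : A} (hx : ∀ i ∈ s, ∃ u ∈ J i, x - u ∈ K) :
    ∃ u, (∀ i ∈ s, u ∈ J i) ∧ x - u ∈ K := by
  classical
  induction s using Finset.induction_on with
  | empty => exact ⟨x, by simp, by simp⟩
  | insert i s _ ih =>
    obtain ⟨y, hy, hxy⟩ := ih fun j hj => hx j (Finset.mem_insert_of_mem hj)
    obtain ⟨z, hz, hxz⟩ := hx i (Finset.mem_insert_self i s)
    obtain ⟨c, hc, hzc, hL⟩ := exists_mem_forall_mem_of_sub_mem (hJ i) hK (y := y) hz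
      (by simpa using K.sub_mem hxy hxz)
    refine ⟨c, fun j hj => ?_, by simpa using K.add_mem hxz hzc⟩
    rcases Finset.mem_insert.mp hj with rfl | hj
    · exact hc
    · exact hL _ (hJ j) (hy j hj)

/-- The Chinese remainder property for finitely many closed ideals of a C⋆-algebra. -/
lemma exists_forall_sub_mem {ι : Type*} {J : ι → TwoSidedIdeal A}
    (hJ : ∀ i, IsClosed (J i : Set A)) {b : ι → A}
    (hb : ∀ i j, ∃ u ∈ J i, ∃ v ∈ J j, b i - b j = u + v) (s : Finset ι) :
    ∃ a, ∀ i ∈ s, a - b i ∈ J i := by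
  classical
  induction s using Finset.induction_on with
  | empty => exact ⟨0, by simp⟩
  | insert k s _ ih =>
    obtain ⟨a, ha⟩ := ih
    obtain ⟨u, hu, hau⟩ := exists_forall_mem_of_forall_exists_add hJ (hJ k) s (x := a - b k)
      fun i hi => by
        obtain ⟨u, hu, v, hv, huv⟩ := hb i k
        refine ⟨a - b i + u, (J i).add_mem (ha i hi) hu, ?_⟩
        have : a - b k - (a - b i + u) = v := by
          rw [← sub_sub, sub_sub_sub_cancel_left, huv, add_sub_cancel_left]
        rwa [this]
    refine ⟨a - u, fun i hi => ?_⟩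
    rcases Finset.mem_insert.mp hi with rfl | hi
    · rwa [sub_right_comm]
    · rw [sub_right_comm]
      exact (J i).sub_mem (ha i hi) (hu i hi)

end CStarCovering

/-- Any (finite) covering of a C*-algebra consisting of closed two-sided
ideals is complete. -/
theorem cstar_covering_complete
    {A : Type*} [NormedRing A] [StarRing A] [CStarRing A] [CompleteSpace A]
    [NormedAlgebra ℂ A] [StarModule ℂ A]
    {ι : Type} [Fintype ι] (J : ι → TwoSidedIdeal A)
    (hclosed : ∀ i, IsClosed (J i : Set A))
    (hcov : ∀ x : A, (∀ i, x ∈ J i) → x = 0)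
    (b : ι → A)
    (hb : ∀ i j, ∃ u ∈ J i, ∃ v ∈ J j, b i - b j = u + v) :
    ∃ a : A, ∀ i, a - b i ∈ J i := by
  let _ : CStarAlgebra A := {}
  obtain ⟨a, ha⟩ := CStarCovering.exists_forall_sub_mem hclosed hb Finset.univ
  exact ⟨a, fun i => ha i (Finset.mem_univ i)⟩
end

section
/- Let 0 < q < 1 and let H = ℓ²(ℕ, ℂ) with its standard orthonormal basis (e_i)_{i≥0}. Let S ∈ B(H) be the unilateral shift, S e_i = e_{i+1}, and let T ∈ B(H) be the weighted shift with T e_i = √(1 − q^{i+1}) e_{i+1} for all i ≥ 0. Then the smallest closed unital star-subalgebra of B(H) containing T is equal to the smallest closed unital star-subalgebra of B(H) containing S (both equal the C*-algebra C*(𝔖) of the unilateral shift). -/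
noncomputable section

/-- The Hilbert space ℓ²(ℕ, ℂ). -/
abbrev ellTwo : Type := lp (fun _ : ℕ => ℂ) 2

/-- The standard orthonormal basis vectors of ℓ²(ℕ, ℂ). -/
def eStd (i : ℕ) : ellTwo := lp.single 2 i 1

open scoped InnerProductSpace ComplexOrder
open ContinuousLinearMap Filter Topology

theorem inner_eStd_left (i : ℕ) (x : ellTwo) : ⟪eStd i, x⟫_ℂ = x i := by
  rw [eStd, lp.inner_single_left]
  simp

theorem inner_eStd_eStd (i j : ℕ) : ⟪eStd i, eStd j⟫_ℂ = if i = j then 1 else 0 := by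
  rw [inner_eStd_left, eStd, lp.single_apply]
  simp [Pi.single_apply]

theorem continuousLinearMap_ext_eStd {X Y : ellTwo →L[ℂ] ellTwo}
    (h : ∀ i, X (eStd i) = Y (eStd i)) : X = Y := by
  refine lp.ext_continuousLinearMap ENNReal.ofNat_ne_top fun i => ?_
  ext1
  exact h i

theorem ext_inner_eStd {x y : ellTwo} (h : ∀ i, ⟪eStd i, x⟫_ℂ = ⟪eStd i, y⟫_ℂ) : x = y := by
  ext i
  simpa only [inner_eStd_left] using h i

/-- A diagonal operator with nonnegative entries is positive. -/
theorem nonneg_of_diagonal {X : ellTwo →L[ℂ] ellTwo} {d : ℕ → ℝ} (hd : ∀ i, 0 ≤ d i)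
    (hX : ∀ i, X (eStd i) = (d i : ℂ) • eStd i) : 0 ≤ X := by
  have hsa : star X = X := by
    refine continuousLinearMap_ext_eStd fun i => ext_inner_eStd fun j => ?_
    rw [star_eq_adjoint, adjoint_inner_right, hX, hX, inner_smul_left, inner_smul_right,
      inner_eStd_eStd]
    by_cases h : j = i <;> simp [h]
  have hcoord (x : ellTwo) (i : ℕ) : X x i = d i * x i := by
    rw [← inner_eStd_left, ← adjoint_inner_left, ← star_eq_adjoint, hsa, hX, inner_smul_left,
      inner_eStd_left, Complex.conj_ofReal]
  rw [nonneg_iff_isPositive, isPositive_iff']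
  refine ⟨hsa, fun x => ?_⟩
  rw [lp.inner_eq_tsum]
  refine tsum_nonneg fun i => ?_
  rw [hcoord, ← smul_eq_mul, inner_smul_left, Complex.conj_ofReal]
  exact mul_nonneg (by exact_mod_cast hd i) (by
    rw [inner_self_eq_norm_sq_to_K, ← RCLike.ofReal_pow]
    exact RCLike.ofReal_nonneg.2 (sq_nonneg _))

/-- A fixed point of the contraction `X ↦ B + q • S X S*`, with `S` in a closed star-subalgebra
containing `B`, lies in that subalgebra. -/
theorem mem_of_eq_add_smul_conj {A : Type*} [CStarAlgebra A] {C : StarSubalgebra ℂ A}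
    (hC : IsClosed (C : Set A)) {q : ℝ} (hq0 : 0 ≤ q) (hq1 : q < 1) {S B D : A}
    (hS : S ∈ C) (hB : B ∈ C) (hnorm : ‖S‖ ≤ 1)
    (hD : D = B + (q : ℂ) • (S * D * star S)) : D ∈ C := by
  have approx (n : ℕ) : ∃ X ∈ C, ‖X - D‖ ≤ q ^ n * ‖D‖ := by
    induction n with
    | zero => exact ⟨0, zero_mem C, by simp⟩
    | succ n ih =>
      obtain ⟨X, hX, hXD⟩ := ih
      refine ⟨B + (q : ℂ) • (S * X * star S), add_mem hB (C.smul_mem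
        (mul_mem (mul_mem hS hX) (star_mem hS)) _), ?_⟩
      have key : B + (q : ℂ) • (S * X * star S) - D = (q : ℂ) • (S * (X - D) * star S) := by
        nth_rewrite 1 [hD]
        rw [mul_sub, sub_mul, smul_sub]
        abel
      have hconj : ‖S * (X - D) * star S‖ ≤ ‖X - D‖ :=
        calc ‖S * (X - D) * star S‖ ≤ ‖S‖ * ‖X - D‖ * ‖star S‖ := norm_mul₃_le
          _ ≤ 1 * ‖X - D‖ * 1 := by
            rw [norm_star]
            gcongr
          _ = ‖X - D‖ := by ring
      rw [key, norm_smul, Complex.norm_real, Real.norm_of_nonneg hq0, pow_succ', mul_assoc q]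
      exact mul_le_mul_of_nonneg_left (hconj.trans hXD) hq0
  choose X hX hXD using approx
  have hlim : Tendsto X atTop (𝓝 D) := by
    rw [tendsto_iff_norm_sub_tendsto_zero]
    refine squeeze_zero (fun _ => norm_nonneg _) hXD ?_
    simpa using (tendsto_pow_atTop_nhds_zero_of_lt_one hq0 hq1).mul_const ‖D‖
  exact hC.mem_of_tendsto hlim (Eventually.of_forall hX)

theorem mem_of_mul_self_mem {A : Type*} [CStarAlgebra A] [PartialOrder A] [StarOrderedRing A]
    {C : StarSubalgebra ℂ A} (hC : IsClosed (C : Set A)) {b : A} (hb : 0 ≤ b)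
    (h : b * b ∈ C) : b ∈ C := by
  rw [← CFC.sqrt_mul_self b hb, CFC.sqrt_eq_real_sqrt _ hb.isSelfAdjoint.mul_self_nonneg,
    cfcₙ_eq_cfc]
  have : IsClosed (C : Set A) := hC
  exact cfc_mem (𝕜 := ℝ) (𝕜' := ℂ) _ h

theorem isUnit_of_algebraMap_le {A : Type*} [CStarAlgebra A] [PartialOrder A]
    [StarOrderedRing A] {c : ℝ} (hc : 0 < c) {b : A} (h : algebraMap ℝ A c ≤ b) : IsUnit b :=
  CStarAlgebra.isUnit_of_le _ h ⟨by simpa using algebraMap_mono A hc.le,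
    (IsUnit.mk0 _ hc.ne').map (algebraMap ℝ A)⟩

/-- For 0 < q < 1, let S be the unilateral shift (S eᵢ = e_{i+1}) and T
the weighted shift T eᵢ = √(1 - q^{i+1}) e_{i+1} on ℓ²(ℕ, ℂ).  Then the smallest closed
unital star-subalgebra of B(ℓ²) containing T equals the smallest closed unital
star-subalgebra containing S (both equal the C*-algebra of the unilateral shift). -/
theorem weighted_shift_generates_shift_algebra (q : ℝ) (hq0 : 0 < q) (hq1 : q < 1)
    (S T : ellTwo →L[ℂ] ellTwo)
    (hS : ∀ i : ℕ, S (eStd i) = eStd (i + 1))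
    (hT : ∀ i : ℕ, T (eStd i) =
      ((Real.sqrt (1 - q ^ (i + 1)) : ℝ) : ℂ) • eStd (i + 1)) :
    (StarAlgebra.adjoin ℂ {T}).topologicalClosure =
      (StarAlgebra.adjoin ℂ {S}).topologicalClosure := by
  have hpow (i : ℕ) : q ^ (i + 1) ≤ q := pow_le_of_le_one hq0.le hq1.le i.succ_ne_zero
  have hnn (i : ℕ) : 0 ≤ 1 - q ^ (i + 1) := by linarith [hpow i]
  set w : ℕ → ℝ := fun i => Real.sqrt (1 - q ^ (i + 1))
  have hww (i : ℕ) : (w i : ℂ) * w i = 1 - (q : ℂ) ^ (i + 1) := by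
    have : w i * w i = 1 - q ^ (i + 1) := Real.mul_self_sqrt (hnn i)
    exact_mod_cast this
  replace hT (i : ℕ) : T (eStd i) = (w i : ℂ) • eStd (i + 1) := hT i
  have hSS : star S * S = 1 := by
    refine continuousLinearMap_ext_eStd fun i => ext_inner_eStd fun j => ?_
    rw [mul_apply_eq_comp, star_eq_adjoint, adjoint_inner_right, hS, hS, one_apply_eq_self]
    simp [inner_eStd_eStd]
  have hSsucc (i : ℕ) : (star S) (eStd (i + 1)) = eStd i := by
    rw [← hS, ← mul_apply_eq_comp, hSS, one_apply_eq_self]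
  have hSzero : (star S) (eStd 0) = 0 := by
    refine ext_inner_eStd fun j => ?_
    rw [star_eq_adjoint, adjoint_inner_right, hS, inner_eStd_eStd]
    simp
  set R : ellTwo →L[ℂ] ellTwo := star S * T with hR
  have hRe (i : ℕ) : R (eStd i) = (w i : ℂ) • eStd i := by
    rw [hR, mul_apply_eq_comp, hT, map_smul, hSsucc]
  clear_value R
  have hTSR : T = S * R := continuousLinearMap_ext_eStd fun i => by
    rw [mul_apply_eq_comp, hRe, map_smul, hS, hT]
  have hR0 : 0 ≤ R := nonneg_of_diagonal (fun i => Real.sqrt_nonneg _) hRe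
  have hRR : R * R = star T * T := by
    rw [hTSR, star_mul, (IsSelfAdjoint.of_nonneg hR0).star_eq, mul_assoc, ← mul_assoc (star S),
      hSS, one_mul]
  have hRunit : IsUnit R := by
    have hc : 0 < Real.sqrt (1 - q) := Real.sqrt_pos.2 (by linarith)
    have hle : algebraMap ℝ (ellTwo →L[ℂ] ellTwo) (Real.sqrt (1 - q)) ≤ R := by
      rw [← sub_nonneg]
      refine nonneg_of_diagonal (d := fun i => w i - Real.sqrt (1 - q)) (fun i => ?_) fun i => ?_
      · exact sub_nonneg.2 (Real.sqrt_le_sqrt (by linarith [hpow i]))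
      · rw [sub_apply, hRe, Algebra.algebraMap_eq_smul_one, smul_apply, one_apply_eq_self,
          Complex.ofReal_sub, sub_smul, Complex.coe_smul, Complex.coe_smul]
        rfl
    exact isUnit_of_algebraMap_le hc hle
  have hRmem {C : StarSubalgebra ℂ (ellTwo →L[ℂ] ellTwo)}
      (hC : IsClosed (C : Set (ellTwo →L[ℂ] ellTwo))) (h : star T * T ∈ C) : R ∈ C :=
    mem_of_mul_self_mem hC hR0 (hRR ▸ h)
  have hnormS : ‖S‖ ≤ 1 := by
    have h1 : ‖S‖ * ‖S‖ = ‖(1 : ellTwo →L[ℂ] ellTwo)‖ := by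
      rw [← CStarRing.norm_star_mul_self, hSS]
    have h2 : ‖(1 : ellTwo →L[ℂ] ellTwo)‖ ≤ 1 := norm_id_le
    nlinarith [norm_nonneg S]
  have hfix : 1 - star T * T = (q : ℂ) • (1 - S * star S) +
      (q : ℂ) • (S * (1 - star T * T) * star S) := by
    have hRRe (i : ℕ) : (1 - R * R) (eStd i) = (q : ℂ) ^ (i + 1) • eStd i := by
      rw [sub_apply, mul_apply_eq_comp, hRe, map_smul, hRe, smul_smul, hww, one_apply_eq_self,
        sub_smul, one_smul, sub_sub_cancel]
    rw [← hRR]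
    refine continuousLinearMap_ext_eStd fun i => ?_
    rw [hRRe, add_apply, smul_apply, smul_apply, sub_apply, mul_apply_eq_comp, mul_apply_eq_comp,
      mul_apply_eq_comp, one_apply_eq_self]
    cases i with
    | zero => simp [hSzero]
    | succ i => rw [hSsucc, hS, hRRe, map_smul, hS, sub_self, smul_zero, zero_add, smul_smul,
        ← pow_succ']
  apply le_antisymm
  · refine StarAlgebra.elemental.le_of_mem
      (StarSubalgebra.isClosed_topologicalClosure _) ?_
    set C := (StarAlgebra.adjoin ℂ {S}).topologicalClosure
    have hC : IsClosed (C : Set (ellTwo →L[ℂ] ellTwo)) :=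
      StarSubalgebra.isClosed_topologicalClosure _
    have hSC : S ∈ C := StarAlgebra.elemental.self_mem ℂ S
    have hD : 1 - star T * T ∈ C := mem_of_eq_add_smul_conj hC hq0.le hq1 hSC
      (C.smul_mem (sub_mem (one_mem C) (mul_mem hSC (star_mem hSC))) _) hnormS hfix
    have hTT : star T * T ∈ C := by simpa using sub_mem (one_mem C) hD
    rw [hTSR]
    exact mul_mem hSC (hRmem hC hTT)
  · refine StarAlgebra.elemental.le_of_mem
      (StarSubalgebra.isClosed_topologicalClosure _) ?_
    set C := (StarAlgebra.adjoin ℂ {T}).topologicalClosure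
    have hC : IsClosed (C : Set (ellTwo →L[ℂ] ellTwo)) :=
      StarSubalgebra.isClosed_topologicalClosure _
    have hTC : T ∈ C := StarAlgebra.elemental.self_mem ℂ T
    have hRC : R ∈ C := hRmem hC (mul_mem (star_mem hTC) hTC)
    obtain ⟨u, hu⟩ := (StarSubalgebra.coe_isUnit (S := C) (a := ⟨R, hRC⟩)).1 hRunit
    have hinv : R * ((u⁻¹ : Cˣ) : C) = 1 := by
      have := congrArg (Subtype.val : C → _) u.mul_inv
      rwa [hu] at this
    have hSeq : S = T * ((u⁻¹ : Cˣ) : C) := by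
      rw [hTSR, mul_assoc, hinv, mul_one]
    rw [hSeq]
    exact mul_mem hTC (SetLike.coe_mem _)
end
end
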